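/- arXiv:1606.00080 — 2 statements merged into one kernel-verified Lean document; each statement's English description precedes it below -/
import Mathlib

section
/- Let n ≥ 2 and let α ∈ ℂ with Re α > 0. Then for every ξ ∈ ℝⁿ with ξ ≠ 0, the Fourier transform of m_α(x) = Γ(α)^{−1}(1−|x|²)^{α−1}_+ satisfies ∫_{|x|<1} Γ(α)^{−1} (1−|x|²)^{α−1} e^{−2πi x·ξ} dx = π^{−α+1} |ξ|^{−n/2−α+1} J_{n/2+α−1}(2π|ξ|). -/
open MeasureTheory Filter Metric
open scoped RealInnerProductSpace Topology

/-- The Bessel function `J_ν(r)` of complex order `ν` (with `Re ν > -1/2`), given by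
Schläfli's integral representation. -/
noncomputable def besselJ (ν : ℂ) (r : ℝ) : ℂ :=
  (1 / (2 * (Real.pi : ℂ))) *
      (∫ θ in (-Real.pi)..Real.pi,
        Complex.exp (Complex.I * ((r * Real.sin θ : ℝ) : ℂ) - Complex.I * ν * (θ : ℂ))) -
    (Complex.sin (ν * (Real.pi : ℂ)) / (Real.pi : ℂ)) *
      (∫ s in Set.Ioi (0 : ℝ), Complex.exp (-(((r * Real.sinh s : ℝ) : ℂ) + ν * (s : ℂ))))

/-- Polar coordinates for the product of a radial function and a power of a linear form. -/
lemma integral_radial_mul_inner_pow {E : Type*} [NormedAddCommGroup E] [InnerProductSpace ℝ E]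
    [FiniteDimensional ℝ E] [Nontrivial E] [MeasurableSpace E] [BorelSpace E]
    (μ : Measure E) [μ.IsAddHaarMeasure] (f : ℝ → ℂ) (ξ : E) (k : ℕ) :
    ∫ x, f ‖x‖ * ((⟪x, ξ⟫ : ℝ) : ℂ) ^ k ∂μ =
      (∫ ω : sphere (0 : E) 1, ((⟪(ω : E), ξ⟫ : ℝ) : ℂ) ^ k ∂μ.toSphere) *
        ∫ r in Set.Ioi (0 : ℝ), (r : ℂ) ^ (Module.finrank ℝ E - 1 + k) * f r := by
  calc
    ∫ x, f ‖x‖ * ((⟪x, ξ⟫ : ℝ) : ℂ) ^ k ∂μ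
      = ∫ x : ({(0)}ᶜ : Set E), f ‖x.1‖ * ((⟪x.1, ξ⟫ : ℝ) : ℂ) ^ k ∂(μ.comap (↑)) := by
      rw [integral_subtype_comap (measurableSet_singleton _).compl
        fun x ↦ f ‖x‖ * ((⟪x, ξ⟫ : ℝ) : ℂ) ^ k, restrict_compl_singleton]
    _ = ∫ p : sphere (0 : E) 1 × Set.Ioi (0 : ℝ), ((⟪(p.1 : E), ξ⟫ : ℝ) : ℂ) ^ k *
          (((p.2 : ℝ) : ℂ) ^ k * f p.2)
          ∂μ.toSphere.prod (.volumeIoiPow (Module.finrank ℝ E - 1)) := by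
      rw [← μ.measurePreserving_homeomorphUnitSphereProd.integral_comp
        (Homeomorph.measurableEmbedding _)]
      refine integral_congr_ae (.of_forall fun x ↦ ?_)
      have hx : ‖(x : E)‖ ≠ 0 := norm_ne_zero_iff.2 x.2
      have hx' : (‖(x : E)‖ : ℂ) ≠ 0 := by exact_mod_cast hx
      simp only [homeomorphUnitSphereProd_apply_fst_coe, homeomorphUnitSphereProd_apply_snd_coe,
        real_inner_smul_left]
      push_cast
      rw [← mul_assoc, ← mul_pow, mul_right_comm, inv_mul_cancel₀ hx', one_mul, mul_comm]
    _ = (∫ ω : sphere (0 : E) 1, ((⟪(ω : E), ξ⟫ : ℝ) : ℂ) ^ k ∂μ.toSphere) *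
          ∫ r : Set.Ioi (0 : ℝ), ((r : ℝ) : ℂ) ^ k * f r
            ∂.volumeIoiPow (Module.finrank ℝ E - 1) :=
      integral_prod_mul (fun ω : sphere (0 : E) 1 ↦ ((⟪(ω : E), ξ⟫ : ℝ) : ℂ) ^ k)
        (fun r : Set.Ioi (0 : ℝ) ↦ ((r : ℝ) : ℂ) ^ k * f r)
    _ = _ := by
      congr 1
      simp only [Measure.volumeIoiPow, ENNReal.ofReal]
      rw [integral_withDensity_eq_integral_smul,
        integral_subtype_comap measurableSet_Ioi fun a ↦
          Real.toNNReal (a ^ (Module.finrank ℝ E - 1)) • ((a : ℂ) ^ k * f a),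
        setIntegral_congr_fun measurableSet_Ioi fun x hx ↦ ?_]
      · simp only [NNReal.smul_def, Real.coe_toNNReal _ (pow_nonneg (le_of_lt hx) _)]
        rw [Complex.real_smul]
        push_cast
        ring
      · exact (measurable_subtype_coe.pow_const _).real_toNNReal

lemma integral_radial_mul_inner_pow_odd {E : Type*} [NormedAddCommGroup E] [InnerProductSpace ℝ E]
    [MeasurableSpace E] [BorelSpace E] (μ : Measure E) [μ.IsNegInvariant]
    (f : ℝ → ℂ) (ξ : E) {k : ℕ} (hk : Odd k) :
    ∫ x, f ‖x‖ * ((⟪x, ξ⟫ : ℝ) : ℂ) ^ k ∂μ = 0 := by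
  have h := integral_neg_eq_self (fun x ↦ f ‖x‖ * ((⟪x, ξ⟫ : ℝ) : ℂ) ^ k) μ
  simp only [norm_neg, inner_neg_left, Complex.ofReal_neg, hk.neg_pow, mul_neg, integral_neg] at h
  exact self_eq_neg.mp h.symm

lemma integral_pow_two_mul_exp_neg_sq (k : ℕ) :
    ∫ t : ℝ, t ^ (2 * k) * Real.exp (-t ^ 2) = Real.Gamma (k + 1 / 2) := by
  have h := integral_comp_abs (f := fun t : ℝ ↦ t ^ (2 * k) * Real.exp (-t ^ 2))
  simp only [sq_abs, pow_mul] at h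
  simp only [pow_mul]
  rw [h]
  have h2 := integral_rpow_mul_exp_neg_rpow (p := 2) (q := 2 * k) two_pos
    (by linarith [(k.cast_nonneg : (0 : ℝ) ≤ k)])
  have h3 : ∫ x in Set.Ioi (0 : ℝ), (x ^ 2) ^ k * Real.exp (-x ^ 2) =
      ∫ x in Set.Ioi (0 : ℝ), x ^ (2 * k : ℝ) * Real.exp (-x ^ (2 : ℝ)) := by
    refine setIntegral_congr_fun measurableSet_Ioi fun x _ ↦ ?_
    have : (2 * k : ℝ) = ((2 * k : ℕ) : ℝ) := by push_cast; rfl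
    simp only [this, Real.rpow_natCast, Real.rpow_two, pow_mul]
  rw [h3, h2, show ((2 * k + 1) / 2 : ℝ) = k + 1 / 2 by ring]
  ring

lemma integral_exp_neg_norm_sq_mul_inner_pow {n : ℕ} (hn : 0 < n)
    (ξ : EuclideanSpace ℝ (Fin n)) (k : ℕ) :
    ∫ x : EuclideanSpace ℝ (Fin n), Real.exp (-‖x‖ ^ 2) * ⟪x, ξ⟫ ^ (2 * k) =
      ‖ξ‖ ^ (2 * k) * (Real.Gamma (k + 1 / 2) * √Real.pi ^ (n - 1)) := by
  let i₀ : Fin n := ⟨0, hn⟩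
  let e : EuclideanSpace ℝ (Fin n) := EuclideanSpace.single i₀ ‖ξ‖
  have he : ‖ξ‖ = ‖e‖ := by simp [e]
  let R := Submodule.reflection (Submodule.span ℝ {ξ - e})ᗮ
  have hR : R ξ = e := Submodule.reflection_sub he
  have h1 : ∫ x : EuclideanSpace ℝ (Fin n), Real.exp (-‖x‖ ^ 2) * ⟪x, ξ⟫ ^ (2 * k) =
      ∫ x : EuclideanSpace ℝ (Fin n), Real.exp (-‖x‖ ^ 2) * ⟪x, e⟫ ^ (2 * k) := by
    rw [← R.measurePreserving.integral_comp R.toHomeomorph.measurableEmbedding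
      (fun x ↦ Real.exp (-‖x‖ ^ 2) * ⟪x, e⟫ ^ (2 * k))]
    refine integral_congr_ae (.of_forall fun x ↦ ?_)
    have := R.inner_map_map x ξ
    rw [hR] at this
    simp only [LinearIsometryEquiv.norm_map, this]
  rw [h1, ← (PiLp.volume_preserving_toLp (Fin n)).integral_comp
    (MeasurableEquiv.toLp 2 (Fin n → ℝ)).measurableEmbedding]
  have h2 : ∀ x : Fin n → ℝ, Real.exp (-‖WithLp.toLp 2 x‖ ^ 2) * ⟪WithLp.toLp 2 x, e⟫ ^ (2 * k) =
      ‖ξ‖ ^ (2 * k) *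
        ∏ i, (if i = i₀ then x i ^ (2 * k) else 1) * Real.exp (-(x i) ^ 2) := by
    intro x
    rw [Finset.prod_mul_distrib, ← Real.exp_sum, EuclideanSpace.real_norm_sq_eq,
      Finset.prod_ite_eq' Finset.univ i₀ (fun i ↦ x i ^ (2 * k)),
      Finset.sum_neg_distrib]
    simp [e, EuclideanSpace.inner_single_right]
    ring
  simp only [h2]
  rw [integral_const_mul, integral_fintype_prod_volume_eq_prod
    (f := fun i (t : ℝ) ↦ (if i = i₀ then t ^ (2 * k) else 1) * Real.exp (-t ^ 2)),
    ← Finset.mul_prod_erase Finset.univ _ (Finset.mem_univ i₀)]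
  congr 2
  · simpa using integral_pow_two_mul_exp_neg_sq k
  · rw [Finset.prod_congr rfl (g := fun _ ↦ √Real.pi), Finset.prod_const]
    · simp
    · intro i hi
      have := integral_gaussian 1
      simpa [Finset.ne_of_mem_erase hi] using this

/-- Even moments of a radial function on Euclidean space. -/
lemma integral_radial_mul_inner_pow_even {n : ℕ} (hn : 0 < n) (f : ℝ → ℂ)
    (ξ : EuclideanSpace ℝ (Fin n)) (k : ℕ) :
    ∫ x : EuclideanSpace ℝ (Fin n), f ‖x‖ * ((⟪x, ξ⟫ : ℝ) : ℂ) ^ (2 * k) =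
      ((2 * (‖ξ‖ ^ (2 * k) * (Real.Gamma (k + 1 / 2) * √Real.pi ^ (n - 1))) /
          Real.Gamma (n / 2 + k) : ℝ) : ℂ) *
        ∫ r in Set.Ioi (0 : ℝ), (r : ℂ) ^ (n - 1 + 2 * k) * f r := by
  have : Nonempty (Fin n) := ⟨⟨0, hn⟩⟩
  have hG := integral_radial_mul_inner_pow (volume : Measure (EuclideanSpace ℝ (Fin n)))
    (fun r ↦ ((Real.exp (-r ^ 2) : ℝ) : ℂ)) ξ (2 * k)
  have hm := integral_exp_neg_norm_sq_mul_inner_pow hn ξ k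
  have hr : ∫ r in Set.Ioi (0 : ℝ), r ^ (n - 1 + 2 * k) * Real.exp (-r ^ 2) =
      Real.Gamma (n / 2 + k) / 2 := by
    have h2 := integral_rpow_mul_exp_neg_rpow (p := 2) (q := (n - 1 + 2 * k : ℕ)) two_pos
      (by linarith [((n - 1 + 2 * k).cast_nonneg : (0 : ℝ) ≤ _)])
    simp only [Real.rpow_natCast, Real.rpow_two] at h2
    rw [h2, show ((((n - 1 + 2 * k : ℕ) : ℝ) + 1) / 2 : ℝ) = n / 2 + k by
      push_cast [Nat.cast_sub (Nat.succ_le_of_lt hn)]; ring]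
    ring
  have hpos : (0 : ℝ) < Real.Gamma (n / 2 + k) := by
    apply Real.Gamma_pos_of_pos
    have : (0 : ℝ) < n := by exact_mod_cast hn
    positivity
  rw [integral_radial_mul_inner_pow, finrank_euclideanSpace_fin]
  congr 1
  have c1 : ∫ x : EuclideanSpace ℝ (Fin n), ((Real.exp (-‖x‖ ^ 2) : ℝ) : ℂ) *
      ((⟪x, ξ⟫ : ℝ) : ℂ) ^ (2 * k) = ((‖ξ‖ ^ (2 * k) * (Real.Gamma (k + 1 / 2) *
        √Real.pi ^ (n - 1)) : ℝ) : ℂ) := by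
    rw [← hm, ← integral_complex_ofReal]
    push_cast
    rfl
  have c2 : ∫ r in Set.Ioi (0 : ℝ), (r : ℂ) ^ (n - 1 + 2 * k) * ((Real.exp (-r ^ 2) : ℝ) : ℂ) =
      ((Real.Gamma (n / 2 + k) / 2 : ℝ) : ℂ) := by
    rw [← hr, ← integral_complex_ofReal]
    push_cast
    rfl
  rw [c1, finrank_euclideanSpace_fin, c2] at hG
  have hne : ((Real.Gamma (n / 2 + k) : ℝ) : ℂ) ≠ 0 := by exact_mod_cast hpos.ne'
  rw [Complex.ofReal_div, Complex.ofReal_mul, hG, eq_div_iff hne, Complex.ofReal_div]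
  push_cast
  ring

lemma indicator_comp_sq_eq (α : ℂ) (m : ℕ) {r : ℝ} (hr : 0 < r) :
    (2 * r ^ ((2 : ℝ) - 1)) • (Set.Iio (1 : ℝ)).indicator
      (fun u : ℝ ↦ (u : ℂ) ^ (((m : ℂ) + 1) / 2 - 1) * (1 - (u : ℂ)) ^ (α - 1)) (r ^ (2 : ℝ)) =
    2 * ((r : ℂ) ^ m *
      (Set.Iio (1 : ℝ)).indicator (fun r : ℝ ↦ ((1 - r ^ 2 : ℝ) : ℂ) ^ (α - 1)) r) := by
  have hr' : (r : ℂ) ≠ 0 := by exact_mod_cast hr.ne'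
  have hiff : r ^ (2 : ℝ) < 1 ↔ r < 1 := by
    rw [Real.rpow_two, sq_lt_one_iff₀ hr.le]
  by_cases h : r < 1
  · rw [Set.indicator_of_mem (Set.mem_Iio.2 (hiff.2 h)), Set.indicator_of_mem (show r ∈ Set.Iio 1 from h)]
    have e1 : (((r ^ (2 : ℝ) : ℝ)) : ℂ) ^ (((m : ℂ) + 1) / 2 - 1) * r = (r : ℂ) ^ m := by
      rw [Complex.ofReal_cpow hr.le, ← Complex.ofReal_cpow hr.le, Real.rpow_two, sq,
        Complex.ofReal_mul, Complex.mul_cpow_ofReal_nonneg hr.le hr.le, ← Complex.cpow_add _ _ hr']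
      nth_rw 2 [← Complex.cpow_one (r : ℂ)]
      rw [← Complex.cpow_add _ _ hr', ← Complex.cpow_natCast]
      congr 1
      ring
    rw [← e1, show (2 : ℝ) - 1 = 1 by norm_num, Real.rpow_one, Complex.real_smul]
    rw [Real.rpow_two]
    push_cast
    ring
  · rw [Set.indicator_of_notMem (mt Set.mem_Iio.1 (mt hiff.1 h)),
      Set.indicator_of_notMem (show r ∉ Set.Iio 1 from h)]
    simp

lemma setIntegral_pow_mul_one_sub_sq_cpow (α : ℂ) (m : ℕ) :
    ∫ r in Set.Ioi (0 : ℝ), (r : ℂ) ^ m *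
      (Set.Iio (1 : ℝ)).indicator (fun r : ℝ ↦ ((1 - r ^ 2 : ℝ) : ℂ) ^ (α - 1)) r =
    Complex.betaIntegral (((m : ℂ) + 1) / 2) α / 2 := by
  have h := integral_comp_rpow_Ioi_of_pos (p := 2) two_pos
    (g := (Set.Iio (1 : ℝ)).indicator
      (fun u : ℝ ↦ (u : ℂ) ^ (((m : ℂ) + 1) / 2 - 1) * (1 - (u : ℂ)) ^ (α - 1)))
  rw [setIntegral_congr_fun measurableSet_Ioi
    (fun r hr ↦ indicator_comp_sq_eq α m hr), integral_const_mul,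
    setIntegral_indicator measurableSet_Iio, Set.Ioi_inter_Iio, ← integral_Ioc_eq_integral_Ioo,
    ← intervalIntegral.integral_of_le zero_le_one] at h
  rw [Complex.betaIntegral, ← h]
  ring

lemma integrableOn_pow_mul_one_sub_sq_cpow {α : ℂ} (hα : 0 < α.re) (m : ℕ) :
    IntegrableOn (fun r : ℝ ↦ (r : ℂ) ^ m *
      (Set.Iio (1 : ℝ)).indicator (fun r : ℝ ↦ ((1 - r ^ 2 : ℝ) : ℂ) ^ (α - 1)) r)
      (Set.Ioi (0 : ℝ)) := by
  have h := (integrableOn_Ioi_comp_rpow_iff (p := 2) ((Set.Iio (1 : ℝ)).indicator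
      (fun u : ℝ ↦ (u : ℂ) ^ (((m : ℂ) + 1) / 2 - 1) * (1 - (u : ℂ)) ^ (α - 1))) two_ne_zero).2 ?_
  · rw [abs_two, integrableOn_congr_fun (fun r hr ↦ indicator_comp_sq_eq α m (Set.mem_Ioi.1 hr))
      measurableSet_Ioi] at h
    refine (h.const_mul (1 / 2)).congr (.of_forall fun r ↦ ?_)
    simp only
    ring
  · rw [integrableOn_indicator_iff measurableSet_Iio, Set.inter_comm, Set.Ioi_inter_Iio,
      ← integrableOn_Ioc_iff_integrableOn_Ioo]
    refine (intervalIntegrable_iff_integrableOn_Ioc_of_le zero_le_one).1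
      (Complex.betaIntegral_convergent ?_ hα)
    have : (((m : ℂ) + 1) / 2).re = ((m : ℝ) + 1) / 2 := by
      rw [show ((m : ℂ) + 1) / 2 = (((m + 1) / 2 : ℝ) : ℂ) by push_cast; rfl, Complex.ofReal_re]
    rw [this]
    positivity

lemma integrable_one_sub_norm_sq_cpow {n : ℕ} (hn : 0 < n) {α : ℂ} (hα : 0 < α.re) :
    Integrable (fun x : EuclideanSpace ℝ (Fin n) ↦
      (Set.Iio (1 : ℝ)).indicator (fun r : ℝ ↦ ((1 - r ^ 2 : ℝ) : ℂ) ^ (α - 1)) ‖x‖) := by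
  have : Nonempty (Fin n) := ⟨⟨0, hn⟩⟩
  rw [integrable_fun_norm_addHaar, finrank_euclideanSpace_fin]
  refine (integrableOn_pow_mul_one_sub_sq_cpow hα (n - 1)).congr_fun (fun r _ ↦ ?_)
    measurableSet_Ioi
  simp [Complex.real_smul]

lemma integral_one_sub_norm_sq_cpow_mul_inner_pow {n : ℕ} (hn : 0 < n) {α : ℂ} (hα : 0 < α.re)
    (ξ : EuclideanSpace ℝ (Fin n)) (k : ℕ) :
    ∫ x : EuclideanSpace ℝ (Fin n),
      (Set.Iio (1 : ℝ)).indicator (fun r : ℝ ↦ ((1 - r ^ 2 : ℝ) : ℂ) ^ (α - 1)) ‖x‖ *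
        ((⟪x, ξ⟫ : ℝ) : ℂ) ^ (2 * k) =
      Complex.Gamma α * ((Real.pi : ℂ) ^ ((n : ℂ) / 2) * (‖ξ‖ : ℂ) ^ (2 * k) * (2 * k).factorial /
        (4 ^ k * k.factorial * Complex.Gamma (n / 2 + α + k))) := by
  have hn' : (0 : ℝ) < n := by exact_mod_cast hn
  have hs : 0 < ((n : ℂ) / 2 + k).re := by
    rw [show ((n : ℂ) / 2 + k) = ((n / 2 + k : ℝ) : ℂ) by push_cast; rfl, Complex.ofReal_re]
    positivity
  have hG : Complex.Gamma ((n : ℂ) / 2 + k) ≠ 0 := Complex.Gamma_ne_zero_of_re_pos hs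
  have hGα : Complex.Gamma ((n : ℂ) / 2 + α + k) ≠ 0 := by
    apply Complex.Gamma_ne_zero_of_re_pos
    rw [add_right_comm, Complex.add_re]
    positivity
  have hβ := Complex.Gamma_mul_Gamma_eq_betaIntegral hs hα
  rw [add_right_comm] at hβ
  have hm : ((n - 1 + 2 * k : ℕ) + 1 : ℂ) / 2 = n / 2 + k := by
    push_cast [Nat.cast_sub (Nat.succ_le_of_lt hn)]; ring
  have hdup : (k.factorial : ℝ) * Real.Gamma (k + 1 / 2) = (2 * k).factorial / 4 ^ k * √Real.pi := by
    have := Real.Gamma_mul_Gamma_add_half (k + 1 / 2)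
    rw [show (k : ℝ) + 1 / 2 + 1 / 2 = k + 1 by ring, Real.Gamma_nat_eq_factorial,
      show 2 * ((k : ℝ) + 1 / 2) = ((2 * k : ℕ) : ℝ) + 1 by push_cast; ring,
      Real.Gamma_nat_eq_factorial,
      show 1 - (((2 * k : ℕ) : ℝ) + 1) = -((2 * k : ℕ) : ℝ) by ring,
      Real.rpow_neg two_pos.le, Real.rpow_natCast, pow_mul] at this
    rw [mul_comm, this, show (2 : ℝ) ^ 2 = 4 by norm_num, div_eq_mul_inv]
  have hpi : ((√Real.pi : ℝ) : ℂ) * ((√Real.pi : ℝ) : ℂ) ^ (n - 1) =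
      (Real.pi : ℂ) ^ ((n : ℂ) / 2) := by
    rw [← pow_succ', Nat.sub_add_cancel hn, Real.sqrt_eq_rpow, ← Complex.ofReal_pow,
      ← Real.rpow_natCast, ← Real.rpow_mul Real.pi_pos.le, Complex.ofReal_cpow Real.pi_pos.le]
    push_cast
    congr 1
    ring
  have hk : (k.factorial : ℂ) ≠ 0 := by exact_mod_cast k.factorial_ne_zero
  have hdup' : ((Real.Gamma (k + 1 / 2) : ℝ) : ℂ) =
      (2 * k).factorial / 4 ^ k * ((√Real.pi : ℝ) : ℂ) / k.factorial := by
    rw [eq_div_iff hk, mul_comm, ← Complex.ofReal_natCast, ← Complex.ofReal_mul, hdup]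
    push_cast
    rfl
  have hβ' : Complex.betaIntegral ((n : ℂ) / 2 + k) α = Complex.Gamma ((n : ℂ) / 2 + k) *
      Complex.Gamma α / Complex.Gamma ((n : ℂ) / 2 + α + k) := by
    rw [eq_div_iff hGα, hβ, mul_comm]
  have hGr : ((Real.Gamma (n / 2 + k) : ℝ) : ℂ) = Complex.Gamma ((n : ℂ) / 2 + k) := by
    rw [← Complex.Gamma_ofReal]; push_cast; rfl
  rw [integral_radial_mul_inner_pow_even hn, setIntegral_pow_mul_one_sub_sq_cpow, hm, hβ',
    Complex.ofReal_div, Complex.ofReal_mul, Complex.ofReal_mul, Complex.ofReal_mul, hdup', hGr,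
    Complex.ofReal_pow, Complex.ofReal_pow, ← hpi]
  push_cast
  generalize Complex.Gamma ((n : ℂ) / 2 + k) = G₁ at *
  generalize Complex.Gamma ((n : ℂ) / 2 + α + k) = G₂ at *
  field_simp

/-- The Fourier transform of `Γ(α)⁻¹ (1 - |x|²)^{α-1}_+` as a power series. -/
lemma hasSum_fourier_transform_m_alpha {n : ℕ} (hn : 0 < n) {α : ℂ} (hα : 0 < α.re)
    (ξ : EuclideanSpace ℝ (Fin n)) :
    HasSum (fun k : ℕ ↦ (Real.pi : ℂ) ^ ((n : ℂ) / 2) *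
        ((-1) ^ k * ((Real.pi * ‖ξ‖ : ℝ) : ℂ) ^ (2 * k) /
          (k.factorial * Complex.Gamma (n / 2 + α + k))))
      (∫ x in {x : EuclideanSpace ℝ (Fin n) | ‖x‖ < 1},
        (Complex.Gamma α)⁻¹ * (((1 - ‖x‖ ^ 2 : ℝ) : ℂ) ^ (α - 1)) *
          Complex.exp (((-(2 * Real.pi * ⟪x, ξ⟫) : ℝ) : ℂ) * Complex.I)) := by
  set F : ℝ → ℂ := (Set.Iio (1 : ℝ)).indicator (fun r : ℝ ↦ ((1 - r ^ 2 : ℝ) : ℂ) ^ (α - 1))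
    with hF
  have hFint : Integrable (fun x : EuclideanSpace ℝ (Fin n) ↦ F ‖x‖) :=
    integrable_one_sub_norm_sq_cpow hn hα
  have hms : MeasurableSet {x : EuclideanSpace ℝ (Fin n) | ‖x‖ < 1} :=
    measurableSet_lt measurable_norm measurable_const
  have hL : (∫ x in {x : EuclideanSpace ℝ (Fin n) | ‖x‖ < 1},
        (Complex.Gamma α)⁻¹ * (((1 - ‖x‖ ^ 2 : ℝ) : ℂ) ^ (α - 1)) *
          Complex.exp (((-(2 * Real.pi * ⟪x, ξ⟫) : ℝ) : ℂ) * Complex.I)) =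
      ∫ x : EuclideanSpace ℝ (Fin n), (Complex.Gamma α)⁻¹ * (F ‖x‖ *
          Complex.exp (((-(2 * Real.pi * ⟪x, ξ⟫) : ℝ) : ℂ) * Complex.I)) := by
    rw [← integral_indicator hms]
    refine integral_congr_ae (.of_forall fun x ↦ ?_)
    by_cases hx : ‖x‖ < 1
    · simp [hF, hx, mul_assoc]
    · simp [hF, hx]
  have hS : HasSum (fun j : ℕ ↦ ∫ x : EuclideanSpace ℝ (Fin n), (Complex.Gamma α)⁻¹ *
      ((-(2 * Real.pi) * Complex.I) ^ j / j.factorial * (F ‖x‖ * ((⟪x, ξ⟫ : ℝ) : ℂ) ^ j)))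
      (∫ x : EuclideanSpace ℝ (Fin n), (Complex.Gamma α)⁻¹ * (F ‖x‖ *
          Complex.exp (((-(2 * Real.pi * ⟪x, ξ⟫) : ℝ) : ℂ) * Complex.I))) := by
    have hsum : Summable fun j : ℕ ↦ (2 * Real.pi * ‖ξ‖) ^ j / (j.factorial : ℝ) :=
      Real.summable_pow_div_factorial _
    refine hasSum_integral_of_dominated_convergence
      (fun j x ↦ ‖(Complex.Gamma α)⁻¹‖ * ‖F ‖x‖‖ * ((2 * Real.pi * ‖ξ‖) ^ j / j.factorial))
      (fun j ↦ ?_) (fun j ↦ .of_forall fun x ↦ ?_) (.of_forall fun x ↦ hsum.mul_left _) ?_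
      (.of_forall fun x ↦ ?_)
    · refine ((hFint.1.mul ?_).const_mul _).const_mul _
      exact Continuous.aestronglyMeasurable (by fun_prop)
    · by_cases hx : ‖x‖ < 1
      · have h1 : |⟪x, ξ⟫| ≤ ‖ξ‖ := by
          refine (abs_real_inner_le_norm x ξ).trans ?_
          nlinarith [norm_nonneg ξ]
        simp only [norm_mul, norm_div, norm_pow, norm_neg, Complex.norm_I, mul_one,
          Complex.norm_real, Real.norm_eq_abs, Complex.norm_two, abs_of_pos Real.pi_pos,
          Complex.norm_natCast]
        rw [mul_assoc, mul_pow (2 * Real.pi)]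
        have h2 : |⟪x, ξ⟫| ^ j ≤ ‖ξ‖ ^ j := by gcongr
        have h3 : (0 : ℝ) ≤ (2 * Real.pi) ^ j / j.factorial := by positivity
        refine mul_le_mul_of_nonneg_left ?_ (norm_nonneg _)
        calc _ = ‖F ‖x‖‖ * ((2 * Real.pi) ^ j / j.factorial) * |⟪x, ξ⟫| ^ j := by ring
          _ ≤ ‖F ‖x‖‖ * ((2 * Real.pi) ^ j / j.factorial) * ‖ξ‖ ^ j := by gcongr
          _ = _ := by ring
      · simp [hF, hx]
    · simp_rw [tsum_mul_left]
      exact (hFint.norm.const_mul _).mul_const _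
    · have := NormedSpace.expSeries_div_hasSum_exp
        (((-(2 * Real.pi * ⟪x, ξ⟫) : ℝ) : ℂ) * Complex.I)
      rw [← Complex.exp_eq_exp_ℂ] at this
      convert! (this.mul_left (F ‖x‖)).mul_left (Complex.Gamma α)⁻¹ using 2 with j
      rw [show (((-(2 * Real.pi * ⟪x, ξ⟫) : ℝ) : ℂ) * Complex.I) =
        (-(2 * Real.pi) * Complex.I) * ((⟪x, ξ⟫ : ℝ) : ℂ) by push_cast; ring, mul_pow]
      ring
  rw [hL]
  have hinj : Function.Injective fun k : ℕ ↦ 2 * k := fun a b h ↦ by simpa using h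
  rw [← hinj.hasSum_iff] at hS
  · convert! hS using 2 with k
    have hΓ : Complex.Gamma α ≠ 0 := Complex.Gamma_ne_zero_of_re_pos hα
    have hI : (-(2 * Real.pi) * Complex.I) ^ (2 * k) = (-1) ^ k * 4 ^ k * (Real.pi : ℂ) ^ (2 * k) := by
      rw [pow_mul, mul_pow, Complex.I_sq, pow_mul, ← mul_pow, ← mul_pow]
      ring
    have hk : ((2 * k).factorial : ℂ) ≠ 0 := by exact_mod_cast (2 * k).factorial_ne_zero
    simp only [Function.comp_apply]
    rw [integral_const_mul, integral_const_mul,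
      integral_one_sub_norm_sq_cpow_mul_inner_pow hn hα, hI]
    push_cast
    rw [mul_pow]
    field_simp
  · intro j hj
    have hodd : Odd j := by
      rw [← Nat.not_even_iff_odd]
      rintro ⟨m, rfl⟩
      exact hj ⟨m, by simp [two_mul]⟩
    rw [integral_const_mul, integral_const_mul, integral_radial_mul_inner_pow_odd _ _ _ hodd]
    simp

lemma hasSum_integral_mul_exp {X : Type*} [MeasurableSpace X] {μ : Measure X} {g h : X → ℂ}
    (hg : Integrable g μ) (hh : AEStronglyMeasurable h μ) (hb : ∀ᵐ a ∂μ, ‖h a‖ ≤ 1) (z : ℂ) :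
    HasSum (fun k : ℕ ↦ z ^ k / k.factorial * ∫ a, g a * h a ^ k ∂μ)
      (∫ a, g a * Complex.exp (z * h a) ∂μ) := by
  have hsum : Summable fun j : ℕ ↦ ‖z‖ ^ j / (j.factorial : ℝ) :=
    Real.summable_pow_div_factorial _
  simp_rw [← integral_const_mul]
  refine hasSum_integral_of_dominated_convergence
    (fun j x ↦ ‖g x‖ * (‖z‖ ^ j / j.factorial))
    (fun j ↦ (hg.1.mul (hh.pow j)).const_mul _) (fun j ↦ ?_)
    (.of_forall fun x ↦ hsum.mul_left _) ?_ (.of_forall fun x ↦ ?_)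
  · filter_upwards [hb] with a ha
    simp only [norm_mul, norm_div, norm_pow, Complex.norm_natCast]
    have := pow_le_one₀ (norm_nonneg (h a)) ha (n := j)
    calc _ = ‖g a‖ * (‖z‖ ^ j / j.factorial) * ‖h a‖ ^ j := by ring
      _ ≤ ‖g a‖ * (‖z‖ ^ j / j.factorial) * 1 := by gcongr
      _ = _ := by ring
  · simp_rw [tsum_mul_left]
    exact hg.norm.mul_const _
  · have := NormedSpace.expSeries_div_hasSum_exp (z * h x)
    rw [← Complex.exp_eq_exp_ℂ] at this
    convert! this.mul_left (g x) using 2 with j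
    rw [mul_pow]
    ring

/-- The unit-circle part of Hankel's contour integral for the reciprocal Gamma function. -/
noncomputable def hankelArc (μ : ℂ) (x : ℝ) : ℂ :=
  ∫ θ in (-Real.pi)..Real.pi, Complex.exp (x * Complex.exp (Complex.I * θ) - Complex.I * μ * θ)

/-- The part of Hankel's contour integral along the negative real axis. -/
noncomputable def hankelRay (μ : ℂ) (x : ℝ) : ℂ :=
  ∫ s in Set.Ioi (0 : ℝ), Complex.exp (-(x * Complex.exp s + μ * s))

/-- Hankel's contour integral. -/
noncomputable def hankel (μ : ℂ) (x : ℝ) : ℂ :=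
  1 / (2 * (Real.pi : ℂ)) * hankelArc μ x -
    Complex.sin (μ * (Real.pi : ℂ)) / (Real.pi : ℂ) * hankelRay μ x

lemma norm_hankelRay_integrand_le (μ : ℂ) {x : ℝ} (hx : 0 < x) {s : ℝ} (hs : 0 ≤ s) :
    ‖Complex.exp (-(x * Complex.exp s + μ * s))‖ ≤
      Real.exp ((μ.re - 1) ^ 2 / (2 * x)) * Real.exp (-s) := by
  rw [Complex.norm_exp, ← Real.exp_add, Real.exp_le_exp]
  have h1 : (-(x * Complex.exp s + μ * s)).re = -(x * Real.exp s + μ.re * s) := by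
    simp [Complex.exp_ofReal_re]
  have h2 : s ^ 2 / 2 ≤ Real.exp s := by
    have := Real.quadratic_le_exp_of_nonneg hs
    linarith
  have h3 : x * (s ^ 2 / 2) ≤ x * Real.exp s := by gcongr
  have h4 : 0 ≤ (x * s + (μ.re - 1)) ^ 2 / (2 * x) := by positivity
  have h5 : (x * s + (μ.re - 1)) ^ 2 / (2 * x) =
      x * (s ^ 2 / 2) + (μ.re - 1) * s + (μ.re - 1) ^ 2 / (2 * x) := by
    field_simp
    ring
  rw [h1]
  linarith

lemma integrableOn_hankelRay (μ : ℂ) {x : ℝ} (hx : 0 < x) :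
    IntegrableOn (fun s : ℝ ↦ Complex.exp (-(x * Complex.exp s + μ * s))) (Set.Ioi 0) := by
  refine Integrable.mono' ((integrableOn_exp_neg_Ioi 0).const_mul
    (Real.exp ((μ.re - 1) ^ 2 / (2 * x)))) (Continuous.aestronglyMeasurable (by fun_prop)) ?_
  filter_upwards [ae_restrict_mem measurableSet_Ioi] with s hs
  exact norm_hankelRay_integrand_le μ hx (le_of_lt hs)

lemma tendsto_hankelRay_integrand (μ : ℂ) {x : ℝ} (hx : 0 < x) :
    Tendsto (fun s : ℝ ↦ Complex.exp (-(x * Complex.exp s + μ * s))) atTop (𝓝 0) := by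
  refine squeeze_zero_norm' (a := fun s ↦ Real.exp ((μ.re - 1) ^ 2 / (2 * x)) * Real.exp (-s)) ?_ ?_
  · filter_upwards [eventually_ge_atTop 0] with s hs
    exact norm_hankelRay_integrand_le μ hx hs
  · simpa using Real.tendsto_exp_neg_atTop_nhds_zero.const_mul
      (Real.exp ((μ.re - 1) ^ 2 / (2 * x)))

lemma mul_hankelRay_add (μ : ℂ) {x : ℝ} (hx : 0 < x) :
    x * hankelRay (μ - 1) x + μ * hankelRay μ x = Complex.exp (-x) := by
  have hd : ∀ s ∈ Set.Ici (0 : ℝ), HasDerivAt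
      (fun s : ℝ ↦ -Complex.exp (-(x * Complex.exp s + μ * s)))
      (x * Complex.exp (-(x * Complex.exp s + (μ - 1) * s)) +
        μ * Complex.exp (-(x * Complex.exp s + μ * s))) s := by
    intro s _
    have h0 : HasDerivAt (fun s : ℂ ↦ -Complex.exp (-(x * Complex.exp s + μ * s)))
        (-(Complex.exp (-(x * Complex.exp s + μ * s)) * -(x * Complex.exp s + μ * 1))) (s : ℂ) :=
      ((((Complex.hasDerivAt_exp (s : ℂ)).const_mul (x : ℂ)).add
        ((hasDerivAt_id (s : ℂ)).const_mul μ)).neg.cexp).neg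
    convert! h0.comp_ofReal using 1
    rw [show -(x * Complex.exp s + (μ - 1) * s) = -(x * Complex.exp s + μ * s) + s by ring,
      Complex.exp_add]
    ring
  have hi1 := (integrableOn_hankelRay (μ - 1) hx).const_mul (x : ℂ)
  have hi2 := (integrableOn_hankelRay μ hx).const_mul μ
  have := integral_Ioi_of_hasDerivAt_of_tendsto' hd (hi1.add hi2)
    (tendsto_hankelRay_integrand μ hx).neg
  rw [integral_add hi1 hi2, integral_const_mul, integral_const_mul] at this
  simpa [hankelRay] using this

lemma mul_hankelArc_sub (μ : ℂ) (x : ℝ) :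
    x * hankelArc (μ - 1) x - μ * hankelArc μ x =
      -(2 * Complex.exp (-x) * Complex.sin (μ * Real.pi)) := by
  have hd : ∀ θ ∈ Set.uIcc (-Real.pi) Real.pi, HasDerivAt
      (fun θ : ℝ ↦ -Complex.I * Complex.exp (x * Complex.exp (Complex.I * θ) - Complex.I * μ * θ))
      (x * Complex.exp (x * Complex.exp (Complex.I * θ) - Complex.I * (μ - 1) * θ) -
        μ * Complex.exp (x * Complex.exp (Complex.I * θ) - Complex.I * μ * θ)) θ := by
    intro θ _
    have h0 : HasDerivAt (fun θ : ℂ ↦ -Complex.I *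
        Complex.exp (x * Complex.exp (Complex.I * θ) - Complex.I * μ * θ))
        (-Complex.I * (Complex.exp (x * Complex.exp (Complex.I * θ) - Complex.I * μ * θ) *
          (x * (Complex.exp (Complex.I * θ) * (Complex.I * 1)) - Complex.I * μ * 1))) (θ : ℂ) :=
      (((((hasDerivAt_id (θ : ℂ)).const_mul Complex.I).cexp.const_mul (x : ℂ)).sub
        ((hasDerivAt_id (θ : ℂ)).const_mul (Complex.I * μ))).cexp).const_mul _
    convert! h0.comp_ofReal using 1
    rw [show x * Complex.exp (Complex.I * θ) - Complex.I * (μ - 1) * θ =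
      x * Complex.exp (Complex.I * θ) - Complex.I * μ * θ + Complex.I * θ by ring,
      Complex.exp_add]
    linear_combination (x * Complex.exp (x * Complex.exp (Complex.I * θ) - Complex.I * μ * θ) *
      Complex.exp (Complex.I * θ) - μ *
      Complex.exp (x * Complex.exp (Complex.I * θ) - Complex.I * μ * θ)) * Complex.I_sq
  have hi : ∀ ν : ℂ, IntervalIntegrable (fun θ : ℝ ↦
      Complex.exp (x * Complex.exp (Complex.I * θ) - Complex.I * ν * θ)) volume
      (-Real.pi) Real.pi := fun ν ↦ Continuous.intervalIntegrable (by fun_prop) _ _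
  have := intervalIntegral.integral_eq_sub_of_hasDerivAt hd
    (((hi (μ - 1)).const_mul _).sub ((hi μ).const_mul _))
  rw [intervalIntegral.integral_sub ((hi (μ - 1)).const_mul _) ((hi μ).const_mul _),
    intervalIntegral.integral_const_mul, intervalIntegral.integral_const_mul] at this
  rw [hankelArc, hankelArc, this]
  have e1 : Complex.exp (Complex.I * Real.pi) = -1 := by rw [mul_comm, Complex.exp_pi_mul_I]
  have e2 : Complex.exp (Complex.I * (-Real.pi : ℝ)) = -1 := by
    push_cast
    rw [mul_neg, Complex.exp_neg, e1]
    norm_num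
  rw [e1, e2, Complex.sin]
  push_cast
  rw [show (x : ℂ) * -1 - Complex.I * μ * Real.pi = -x + -(μ * Real.pi) * Complex.I by ring,
    show (x : ℂ) * -1 - Complex.I * μ * -Real.pi = -x + (μ * Real.pi) * Complex.I by ring,
    Complex.exp_add, Complex.exp_add]
  ring

/-- Integration by parts in Hankel's contour integral. -/
lemma mul_hankel_sub_one (μ : ℂ) {x : ℝ} (hx : 0 < x) :
    x * hankel (μ - 1) x = μ * hankel μ x := by
  have h1 := mul_hankelRay_add μ hx
  have h2 := mul_hankelArc_sub μ x
  have hπ : (Real.pi : ℂ) ≠ 0 := by exact_mod_cast Real.pi_ne_zero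
  have hs : Complex.sin ((μ - 1) * Real.pi) = -Complex.sin (μ * Real.pi) := by
    rw [sub_mul, one_mul, Complex.sin_sub_pi]
  rw [hankel, hankel, hs]
  generalize Complex.sin (μ * Real.pi) = S at *
  field_simp
  linear_combination h2 + 2 * S * h1

lemma hasSum_hankelArc (μ : ℂ) (x : ℝ) :
    HasSum (fun k : ℕ ↦ (x : ℂ) ^ k / k.factorial *
      ∫ θ in (-Real.pi)..Real.pi, Complex.exp (Complex.I * (k - μ) * θ)) (hankelArc μ x) := by
  have hpi : -Real.pi ≤ Real.pi := by linarith [Real.pi_pos]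
  have h := hasSum_integral_mul_exp (μ := volume.restrict (Set.Ioc (-Real.pi) Real.pi))
    (g := fun θ : ℝ ↦ Complex.exp (-(Complex.I * μ * θ)))
    (h := fun θ : ℝ ↦ Complex.exp (Complex.I * θ))
    ((intervalIntegrable_iff_integrableOn_Ioc_of_le hpi).1
      (Continuous.intervalIntegrable (by fun_prop) _ _))
    (Continuous.aestronglyMeasurable (by fun_prop))
    (.of_forall fun θ ↦ by rw [mul_comm, Complex.norm_exp_ofReal_mul_I]) x
  rw [hankelArc]
  simp_rw [intervalIntegral.integral_of_le hpi]
  convert! h using 2 with k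
  · congr 2 with θ
    rw [← Complex.exp_nat_mul, ← Complex.exp_add]
    congr 1
    ring
  · ext θ
    rw [← Complex.exp_add]
    congr 1
    ring

lemma integral_exp_mul_arc {c : ℂ} (hc : c ≠ 0) :
    ∫ θ in (-Real.pi)..Real.pi, Complex.exp (Complex.I * c * θ) =
      2 * Complex.sin (c * Real.pi) / c := by
  rw [integral_exp_mul_complex (mul_ne_zero Complex.I_ne_zero hc), Complex.sin]
  push_cast
  rw [show Complex.I * c * Real.pi = c * Real.pi * Complex.I by ring,
    show Complex.I * c * -Real.pi = -(c * Real.pi) * Complex.I by ring]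
  rw [div_eq_div_iff (mul_ne_zero Complex.I_ne_zero hc) hc, neg_mul]
  linear_combination (Complex.exp (c * Real.pi * Complex.I) -
    Complex.exp (-(c * Real.pi * Complex.I))) * c * Complex.I_sq

lemma sin_natCast_sub_mul_pi (k : ℕ) (μ : ℂ) :
    Complex.sin ((k - μ) * Real.pi) = -((-1) ^ k * Complex.sin (μ * Real.pi)) := by
  rw [sub_mul, Complex.sin_antiperiodic.nat_mul_sub_eq, Complex.sin_neg, mul_neg]

lemma hankel_zero (x : ℝ) : hankel 0 x = 1 := by
  have hπ : (Real.pi : ℂ) ≠ 0 := by exact_mod_cast Real.pi_ne_zero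
  have h := hasSum_hankelArc 0 x
  have h' := hasSum_single (f := fun k : ℕ ↦ (x : ℂ) ^ k / k.factorial *
      ∫ θ in (-Real.pi)..Real.pi, Complex.exp (Complex.I * (k - 0) * θ)) 0 fun k hk ↦ by
    rw [integral_exp_mul_arc (by simpa using hk), sin_natCast_sub_mul_pi]
    simp
  rw [hankel, h.unique h']
  simp
  field_simp
  ring

lemma integral_exp_neg_hankel {μ : ℂ} (hμ : μ.re < 0) {x : ℝ} (hx : 0 < x) :
    ∫ s : ℝ, Complex.exp (-(x * Complex.exp s + μ * s)) =
      (x : ℂ) ^ μ * Complex.Gamma (-μ) := by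
  have h := Complex.integral_cpow_mul_exp_neg_mul_Ioi (a := -μ) (by simpa using hμ) hx
  have him : Real.exp '' Set.univ = Set.Ioi 0 := by rw [Set.image_univ, Real.range_exp]
  rw [← him, integral_image_eq_integral_abs_deriv_smul MeasurableSet.univ
    (fun s _ ↦ (Real.hasDerivAt_exp s).hasDerivWithinAt) Real.exp_injective.injOn,
    setIntegral_univ] at h
  have hx' : (x : ℂ).arg ≠ Real.pi := by
    rw [Complex.arg_ofReal_of_nonneg hx.le]; exact Real.pi_ne_zero.symm
  rw [one_div, Complex.inv_cpow _ _ hx', ← Complex.cpow_neg, neg_neg] at h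
  rw [← h]
  congr 1 with s
  have h0 : ((Real.exp s : ℝ) : ℂ) ≠ 0 := by exact_mod_cast (Real.exp_pos s).ne'
  rw [abs_of_pos (Real.exp_pos s), Complex.real_smul, Complex.cpow_def_of_ne_zero h0,
    ← Complex.ofReal_log (Real.exp_pos s).le, Real.log_exp]
  push_cast
  rw [← Complex.exp_add, ← Complex.exp_add]
  congr 1
  ring

lemma integrableOn_exp_hankel_Iic {μ : ℂ} (hμ : μ.re < 0) {x : ℝ} (hx : 0 < x) :
    IntegrableOn (fun s : ℝ ↦ Complex.exp (-(x * Complex.exp s + μ * s))) (Set.Iic 0) := by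
  refine Integrable.mono' (integrableOn_exp_mul_Iic (a := -μ.re) (by linarith) 0)
    (Continuous.aestronglyMeasurable (by fun_prop)) (.of_forall fun s ↦ ?_)
  rw [Complex.norm_exp, Real.exp_le_exp]
  have := mul_pos hx (Real.exp_pos s)
  simp [Complex.exp_ofReal_re]
  linarith

lemma hasSum_exp_hankel_Iic {μ : ℂ} (hμ : μ.re < 0) (x : ℝ) :
    HasSum (fun k : ℕ ↦ (-x : ℂ) ^ k / k.factorial * (1 / (k - μ)))
      (∫ s in Set.Iic (0 : ℝ), Complex.exp (-(x * Complex.exp s + μ * s))) := by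
  have h := hasSum_integral_mul_exp (μ := volume.restrict (Set.Iic (0 : ℝ)))
    (g := fun s : ℝ ↦ Complex.exp (-μ * s)) (h := fun s : ℝ ↦ Complex.exp s)
    (integrableOn_exp_mul_complex_Iic (a := -μ) (by simpa using hμ) 0)
    (Continuous.aestronglyMeasurable (by fun_prop)) ?_ (-x)
  · convert! h using 2 with k
    · congr 1
      rw [show (∫ s in Set.Iic (0 : ℝ), Complex.exp (-μ * s) * Complex.exp s ^ k) =
        ∫ s in Set.Iic (0 : ℝ), Complex.exp ((k - μ) * s) from ?_,
        integral_exp_mul_complex_Iic]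
      · simp
      · simp only [Complex.sub_re, Complex.natCast_re]
        linarith [(k.cast_nonneg : (0 : ℝ) ≤ k)]
      · congr 1 with s
        rw [← Complex.exp_nat_mul, ← Complex.exp_add]
        congr 1
        ring
    · ext s
      rw [← Complex.exp_add]
      congr 1
      ring
  · filter_upwards [ae_restrict_mem measurableSet_Iic] with s hs
    rw [Complex.norm_exp_ofReal]
    exact Real.exp_le_one_iff.2 hs

lemma hankel_of_re_neg {μ : ℂ} (hμ : μ.re < 0) {x : ℝ} (hx : 0 < x) :
    hankel μ x = (x : ℂ) ^ μ / Complex.Gamma (μ + 1) := by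
  have hπ : (Real.pi : ℂ) ≠ 0 := by exact_mod_cast Real.pi_ne_zero
  have h1 := hasSum_hankelArc μ x
  have h2 := (hasSum_exp_hankel_Iic hμ x).mul_left (-(2 * Complex.sin (μ * Real.pi)))
  have harc : hankelArc μ x = -(2 * Complex.sin (μ * Real.pi)) *
      ∫ s in Set.Iic (0 : ℝ), Complex.exp (-(x * Complex.exp s + μ * s)) := by
    refine h1.unique ?_
    convert! h2 using 2 with k
    have hk : (k : ℂ) - μ ≠ 0 := by
      intro h
      have := congrArg Complex.re h
      simp only [Complex.sub_re, Complex.natCast_re, Complex.zero_re] at this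
      linarith [(k.cast_nonneg : (0 : ℝ) ≤ k)]
    rw [integral_exp_mul_arc hk, sin_natCast_sub_mul_pi, neg_pow]
    ring
  have hsplit := setIntegral_union (Set.Iic_disjoint_Ioi le_rfl) measurableSet_Ioi
    (integrableOn_exp_hankel_Iic hμ hx) (integrableOn_hankelRay μ hx)
  rw [Set.Iic_union_Ioi, setIntegral_univ, integral_exp_neg_hankel hμ hx] at hsplit
  have hrefl := Complex.Gamma_mul_Gamma_one_sub (-μ)
  rw [sub_neg_eq_add, add_comm 1 μ, mul_neg, Complex.sin_neg, mul_comm (Real.pi : ℂ)] at hrefl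
  have hG : hankel μ x = -Complex.sin (μ * Real.pi) / Real.pi *
      ((x : ℂ) ^ μ * Complex.Gamma (-μ)) := by
    rw [hsplit, hankel, harc, hankelRay]
    field_simp
    ring
  rw [hG]
  by_cases hs : Complex.sin (μ * Real.pi) = 0
  · have : Complex.Gamma (μ + 1) = 0 := by
      rw [hs, neg_zero, div_zero] at hrefl
      refine (mul_eq_zero.1 hrefl).resolve_left (Complex.Gamma_ne_zero_of_re_pos ?_)
      simpa using hμ
    simp [hs, this]
  · have hne : Complex.Gamma (μ + 1) ≠ 0 := by
      intro h
      rw [h, mul_zero, eq_comm, div_eq_zero_iff, neg_eq_zero] at hrefl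
      tauto
    rw [eq_div_iff hne]
    calc _ = -Complex.sin (μ * Real.pi) / Real.pi * (x : ℂ) ^ μ *
          (Complex.Gamma (-μ) * Complex.Gamma (μ + 1)) := by ring
      _ = _ := by
        rw [hrefl]
        field_simp

/-- Hankel's formula for the reciprocal Gamma function. -/
lemma hankel_eq (μ : ℂ) {x : ℝ} (hx : 0 < x) :
    hankel μ x = (x : ℂ) ^ μ / Complex.Gamma (μ + 1) := by
  have hx' : (x : ℂ) ≠ 0 := by exact_mod_cast hx.ne'
  obtain ⟨m, hm⟩ := exists_nat_gt μ.re
  induction m generalizing μ with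
  | zero => exact hankel_of_re_neg (by simpa using hm) hx
  | succ m ih =>
    by_cases hμ : μ = 0
    · simp [hμ, hankel_zero]
    · have h := ih (μ - 1) (by push_cast at hm; simp; linarith)
      have hrec := mul_hankel_sub_one μ hx
      rw [h, sub_add_cancel, Complex.cpow_sub _ _ hx', Complex.cpow_one] at hrec
      rw [Complex.Gamma_add_one μ hμ, ← mul_right_inj' hμ, ← hrec]
      field_simp

/-- The power series of the Bessel function. -/
lemma hasSum_besselJ (ν : ℂ) {x : ℝ} (hx : 0 < x) :
    HasSum (fun k : ℕ ↦ (x : ℂ) ^ ν *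
      ((-1) ^ k * (x : ℂ) ^ (2 * k) / (k.factorial * Complex.Gamma (ν + 1 + k))))
      (besselJ ν (2 * x)) := by
  have hpi : -Real.pi ≤ Real.pi := by linarith [Real.pi_pos]
  have hx' : (x : ℂ) ≠ 0 := by exact_mod_cast hx.ne'
  have harc := hasSum_integral_mul_exp (μ := volume.restrict (Set.Ioc (-Real.pi) Real.pi))
    (g := fun θ : ℝ ↦ Complex.exp (x * Complex.exp (Complex.I * θ) - Complex.I * ν * θ))
    (h := fun θ : ℝ ↦ Complex.exp (-θ * Complex.I))
    ((intervalIntegrable_iff_integrableOn_Ioc_of_le hpi).1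
      (Continuous.intervalIntegrable (by fun_prop) _ _))
    (Continuous.aestronglyMeasurable (by fun_prop))
    (.of_forall fun θ ↦ by
      rw [← Complex.ofReal_neg, Complex.norm_exp_ofReal_mul_I]) (-x)
  have hray := hasSum_integral_mul_exp (integrableOn_hankelRay ν hx)
    (h := fun s : ℝ ↦ Complex.exp (-s)) (Continuous.aestronglyMeasurable (by fun_prop)) (by
      filter_upwards [ae_restrict_mem measurableSet_Ioi] with s hs
      rw [← Complex.ofReal_neg, Complex.norm_exp_ofReal]
      exact Real.exp_le_one_iff.2 (by simpa using le_of_lt hs)) x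
  convert! (harc.mul_left (1 / (2 * (Real.pi : ℂ)))).sub
    (hray.mul_left (Complex.sin (ν * (Real.pi : ℂ)) / (Real.pi : ℂ))) using 1
  · ext k
    have h := hankel_eq (ν + k) hx
    have e1 : ∫ θ in Set.Ioc (-Real.pi) Real.pi,
        Complex.exp (x * Complex.exp (Complex.I * θ) - Complex.I * ν * θ) *
          Complex.exp (-θ * Complex.I) ^ k = hankelArc (ν + k) x := by
      rw [hankelArc, intervalIntegral.integral_of_le hpi]
      congr 1 with θ
      rw [← Complex.exp_nat_mul, ← Complex.exp_add]
      congr 1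
      ring
    have e2 : ∫ s in Set.Ioi (0 : ℝ), Complex.exp (-(x * Complex.exp s + ν * s)) *
        Complex.exp (-s) ^ k = hankelRay (ν + k) x := by
      rw [hankelRay]
      congr 1 with s
      rw [← Complex.exp_nat_mul, ← Complex.exp_add]
      congr 1
      ring
    have hs : Complex.sin ((ν + k) * Real.pi) = (-1) ^ k * Complex.sin (ν * Real.pi) := by
      rw [add_mul, Complex.sin_antiperiodic.add_nat_mul_eq]
    rw [hankel, hs, add_right_comm, Complex.cpow_add _ _ hx', Complex.cpow_natCast] at h
    rw [e1, e2]
    have hsq : ((-1 : ℂ) ^ k) ^ 2 = 1 := by rw [← pow_mul, mul_comm, pow_mul]; simp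
    calc _ = (-1) ^ k * x ^ k / k.factorial * ((x : ℂ) ^ ν * (x : ℂ) ^ k /
          Complex.Gamma (ν + 1 + k)) := by
          rw [div_mul_div_comm]
          ring
      _ = _ := by
        rw [← h, neg_pow (x : ℂ)]
        linear_combination (-(x : ℂ) ^ k / k.factorial * Complex.sin (ν * Real.pi) / Real.pi *
          hankelRay (ν + k) x) * hsq
  · rw [besselJ, intervalIntegral.integral_of_le hpi]
    congr 2
    · congr 1 with θ
      rw [← Complex.exp_add]
      congr 1
      push_cast
      rw [Complex.sin, mul_comm Complex.I (θ : ℂ)]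
      linear_combination (x * (Complex.exp (-θ * Complex.I) - Complex.exp (θ * Complex.I))) *
        Complex.I_sq
    · congr 1 with s
      rw [← Complex.exp_add]
      congr 1
      push_cast
      rw [Complex.sinh]
      ring

/-- The Fourier transform of `m_α(x) = Γ(α)⁻¹ (1-|x|²)^{α-1}_+` for `Re α > 0` equals
`π^{1-α} |ξ|^{-n/2-α+1} J_{n/2+α-1}(2π|ξ|)` for `ξ ≠ 0`. -/
theorem fourier_transform_m_alpha (n : ℕ) (hn : 2 ≤ n) (α : ℂ) (hα : 0 < α.re)
    (ξ : EuclideanSpace ℝ (Fin n)) (hξ : ξ ≠ 0) :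
    (∫ x in {x : EuclideanSpace ℝ (Fin n) | ‖x‖ < 1},
        (Complex.Gamma α)⁻¹ * (((1 - ‖x‖ ^ 2 : ℝ) : ℂ) ^ (α - 1)) *
          Complex.exp (((-(2 * Real.pi * ⟪x, ξ⟫) : ℝ) : ℂ) * Complex.I)) =
      (Real.pi : ℂ) ^ ((1 : ℂ) - α) * ((‖ξ‖ : ℝ) : ℂ) ^ (-(n : ℂ) / 2 - α + 1) *
        besselJ ((n : ℂ) / 2 + α - 1) (2 * Real.pi * ‖ξ‖) := by
  have hξ' : 0 < ‖ξ‖ := norm_pos_iff.mpr hξ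
  have hπ : (Real.pi : ℂ) ≠ 0 := Complex.ofReal_ne_zero.mpr Real.pi_ne_zero
  have hξc : ((‖ξ‖ : ℝ) : ℂ) ≠ 0 := Complex.ofReal_ne_zero.mpr hξ'.ne'
  have hJ := (hasSum_besselJ ((n : ℂ) / 2 + α - 1) (mul_pos Real.pi_pos hξ')).mul_left
    ((Real.pi : ℂ) ^ ((1 : ℂ) - α) * ((‖ξ‖ : ℝ) : ℂ) ^ (-(n : ℂ) / 2 - α + 1))
  have hpow : (Real.pi : ℂ) ^ ((1 : ℂ) - α) * ((‖ξ‖ : ℝ) : ℂ) ^ (-(n : ℂ) / 2 - α + 1) *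
      ((Real.pi * ‖ξ‖ : ℝ) : ℂ) ^ ((n : ℂ) / 2 + α - 1) = (Real.pi : ℂ) ^ ((n : ℂ) / 2) := by
    rw [Complex.ofReal_mul, Complex.mul_cpow_ofReal_nonneg Real.pi_pos.le hξ'.le,
      mul_mul_mul_comm, ← Complex.cpow_add _ _ hπ, ← Complex.cpow_add _ _ hξc,
      show -(n : ℂ) / 2 - α + 1 + ((n : ℂ) / 2 + α - 1) = 0 by ring, Complex.cpow_zero, mul_one]
    ring_nf
  rw [mul_assoc 2 Real.pi ‖ξ‖]
  refine (hasSum_fourier_transform_m_alpha (by lia) hα ξ).unique ?_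
  refine (iff_of_eq (congrArg (HasSum · _) (funext fun k ↦ ?_))).mp hJ
  rw [← mul_assoc, hpow, show (n : ℂ) / 2 + α - 1 + 1 + k = n / 2 + α + k by ring]
end

section
/- Let n ≥ 2, let f : ℝⁿ → ℂ be continuous with compact support, let x ∈ ℝⁿ and t > 0. Then lim_{α→0⁺} Γ(α)^{−1} ∫_{|y|<1} (1−|y|²)^{α−1} f(x+ty) dy = (1/2) ∫_{S^{n−1}} f(x+tω) dS(ω), where the limit is taken over real α > 0 and dS is the (unnormalized) surface measure on the unit sphere S^{n−1} ⊂ ℝⁿ. (In the sense of distributions Γ(α)^{−1} t^{α−1}_+ → δ as α → 0⁺, so the analytic family of spherical means 𝓜^α_t f degenerates to the spherical mean as α → 0⁺.) -/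
open MeasureTheory Filter Metric
open scoped Topology

/-- The (unnormalized) rotation-invariant surface measure on the unit sphere `S^{n-1} ⊂ ℝⁿ`. -/
noncomputable def surfMeasure (n : ℕ) : Measure (Metric.sphere (0 : EuclideanSpace ℝ (Fin n)) 1) :=
  (volume : Measure (EuclideanSpace ℝ (Fin n))).toSphere

open Module in
/-- Integration in polar coordinates with respect to an additive Haar measure. -/
theorem integral_eq_integral_Ioi_toSphere {E F : Type*} [NormedAddCommGroup E] [NormedSpace ℝ E]
    [FiniteDimensional ℝ E] [Nontrivial E] [MeasurableSpace E] [BorelSpace E]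
    [NormedAddCommGroup F] [NormedSpace ℝ F]
    (μ : Measure E) [μ.IsAddHaarMeasure] {g : E → F} (hg : Integrable g μ) :
    ∫ y, g y ∂μ = ∫ r in Set.Ioi (0 : ℝ), r ^ (finrank ℝ E - 1) •
      ∫ ω, g (r • (ω : E)) ∂μ.toSphere := by
  have hmp := μ.measurePreserving_homeomorphUnitSphereProd
  have hemb := (homeomorphUnitSphereProd E).measurableEmbedding
  let G : sphere (0 : E) 1 × Set.Ioi (0 : ℝ) → F := fun p => g ((p.2 : ℝ) • (p.1 : E))
  have hG : ∀ y : ({0}ᶜ : Set E), G (homeomorphUnitSphereProd E y) = g y := fun y => by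
    have hy : ‖(y : E)‖ ≠ 0 := norm_ne_zero_iff.2 y.2
    simp [G, smul_smul, hy]
  have hGi : Integrable G (μ.toSphere.prod (.volumeIoiPow (finrank ℝ E - 1))) := by
    rw [← hmp.integrable_comp_emb hemb]
    simp only [Function.comp_def, hG]
    exact (integrableOn_iff_comap_subtypeVal (measurableSet_singleton _).compl).1 hg.integrableOn
  calc
    ∫ y, g y ∂μ = ∫ y : ({0}ᶜ : Set E), g y ∂(μ.comap (↑)) := by
      rw [integral_subtype_comap (measurableSet_singleton _).compl g, restrict_compl_singleton]
    _ = ∫ p, G p ∂μ.toSphere.prod (.volumeIoiPow (finrank ℝ E - 1)) := by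
      rw [← hmp.integral_comp hemb]
      simp only [hG]
    _ = ∫ r : Set.Ioi (0 : ℝ), (∫ ω, g ((r : ℝ) • (ω : E)) ∂μ.toSphere)
          ∂.volumeIoiPow (finrank ℝ E - 1) := integral_prod_symm G hGi
    _ = _ := by
      simp only [Measure.volumeIoiPow, ENNReal.ofReal]
      rw [integral_withDensity_eq_integral_smul,
        integral_subtype_comap measurableSet_Ioi fun a ↦ Real.toNNReal (a ^ (finrank ℝ E - 1)) •
          ∫ ω, g (a • (ω : E)) ∂μ.toSphere,
        setIntegral_congr_fun measurableSet_Ioi fun x hx ↦ ?_]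
      · rw [NNReal.smul_def, Real.coe_toNNReal _ (pow_nonneg (Set.mem_Ioi.1 hx).le _)]
      · exact (measurable_subtype_coe.pow_const _).real_toNNReal

theorem hasDerivAt_neg_one_sub_sq_rpow (α : ℝ) {r : ℝ} (hr : r ∈ Set.Ioo (0 : ℝ) 1) :
    HasDerivAt (fun r : ℝ => -(1 - r ^ 2) ^ α) (2 * α * r * (1 - r ^ 2) ^ (α - 1)) r := by
  have h0 : 1 - r ^ 2 ≠ 0 := by nlinarith [hr.1, hr.2]
  have h := (((hasDerivAt_pow 2 r).const_sub 1).rpow_const (p := α) (Or.inl h0)).neg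
  refine h.congr_deriv ?_
  simp only [Nat.cast_ofNat, Nat.add_one_sub_one, pow_one]
  ring

theorem continuous_neg_one_sub_sq_rpow {α : ℝ} (hα : 0 < α) :
    Continuous fun r : ℝ => -(1 - r ^ 2) ^ α := by
  have : Continuous fun r : ℝ => 1 - r ^ 2 := by fun_prop
  exact (this.rpow_const fun _ => Or.inr hα.le).neg

theorem one_sub_sq_rpow_kernel_nonneg {α : ℝ} (hα : 0 < α) {r : ℝ} (hr : r ∈ Set.Ioo (0 : ℝ) 1) :
    0 ≤ 2 * α * r * (1 - r ^ 2) ^ (α - 1) := by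
  have h0 : 0 ≤ 1 - r ^ 2 := by nlinarith [hr.1, hr.2]
  have := hr.1
  positivity

theorem intervalIntegrable_one_sub_sq_rpow_kernel {α : ℝ} (hα : 0 < α) :
    IntervalIntegrable (fun r : ℝ => 2 * α * r * (1 - r ^ 2) ^ (α - 1)) volume 0 1 := by
  apply intervalIntegral.intervalIntegrable_deriv_of_nonneg
    (continuous_neg_one_sub_sq_rpow hα).continuousOn
  · intro r hr
    exact hasDerivAt_neg_one_sub_sq_rpow α (by simpa using hr)
  · intro r hr
    exact one_sub_sq_rpow_kernel_nonneg hα (by simpa using hr)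

theorem setIntegral_one_sub_sq_rpow_kernel {α : ℝ} (hα : 0 < α) :
    ∫ r in Set.Ioo (0 : ℝ) 1, 2 * α * r * (1 - r ^ 2) ^ (α - 1) = 1 := by
  rw [← integral_Ioc_eq_integral_Ioo, ← intervalIntegral.integral_of_le zero_le_one,
    intervalIntegral.integral_eq_sub_of_hasDerivAt_of_le zero_le_one
      (continuous_neg_one_sub_sq_rpow hα).continuousOn
      (fun r hr => hasDerivAt_neg_one_sub_sq_rpow α hr)
      (intervalIntegrable_one_sub_sq_rpow_kernel hα)]
  simp [Real.zero_rpow hα.ne']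

/-- The kernels `2αr(1-r²)^(α-1)` on `(0, 1)` concentrate at `1` as `α → 0⁺`. -/
theorem tendsto_setIntegral_one_sub_sq_rpow_kernel_smul {F : Type*} [NormedAddCommGroup F]
    [NormedSpace ℝ F] [CompleteSpace F] {g : ℝ → F} (hg : Continuous g) :
    Tendsto (fun α : ℝ => ∫ r in Set.Ioo (0 : ℝ) 1, (2 * α * r * (1 - r ^ 2) ^ (α - 1)) • g r)
      (𝓝[>] 0) (𝓝 (g 1)) := by
  refine tendsto_setIntegral_peak_smul_of_integrableOn_of_tendsto (x₀ := (1 : ℝ))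
    measurableSet_Ioo measurableSet_Ioo subset_rfl self_mem_nhdsWithin (by simp) ?_ ?_ ?_ ?_ ?_ ?_
  · filter_upwards [self_mem_nhdsWithin] with α hα r hr using one_sub_sq_rpow_kernel_nonneg hα hr
  · intro u hu h1u
    obtain ⟨ε, hε, hεu⟩ := Metric.isOpen_iff.1 hu 1 h1u
    rw [Metric.tendstoUniformlyOn_iff]
    intro δ hδ
    have hlim : Tendsto (fun α : ℝ => 2 * α * ε⁻¹) (𝓝[>] 0) (𝓝 0) := by
      have : Continuous fun α : ℝ => 2 * α * ε⁻¹ := by fun_prop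
      simpa using (this.tendsto 0).mono_left nhdsWithin_le_nhds
    filter_upwards [self_mem_nhdsWithin, hlim.eventually_lt_const hδ,
      Ioo_mem_nhdsGT (zero_lt_one (α := ℝ))] with α hα hαδ hα1 r hr
    have hα0 : 0 < α := hα
    have hr0 := hr.1.1
    have hr1 := hr.1.2
    have hrε : ε ≤ 1 - r := by
      by_contra! h
      apply hr.2 (hεu _)
      rw [Metric.mem_ball, Real.dist_eq, abs_lt]
      constructor <;> linarith
    have hle : ε ≤ 1 - r ^ 2 := by nlinarith
    have hpos : 0 < 1 - r ^ 2 := hε.trans_le hle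
    have hpow : (1 - r ^ 2) ^ (α - 1) ≤ ε⁻¹ := by
      calc (1 - r ^ 2) ^ (α - 1) ≤ (1 - r ^ 2) ^ (-1 : ℝ) :=
            Real.rpow_le_rpow_of_exponent_ge hpos (by nlinarith) (by linarith)
        _ = (1 - r ^ 2)⁻¹ := Real.rpow_neg_one _
        _ ≤ ε⁻¹ := inv_anti₀ hε hle
    rw [Pi.zero_apply, dist_zero_left, Real.norm_of_nonneg (one_sub_sq_rpow_kernel_nonneg hα hr.1)]
    refine lt_of_le_of_lt ?_ hαδ
    have hpow0 : 0 ≤ (1 - r ^ 2) ^ (α - 1) := by positivity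
    have hle2 : 2 * α * r ≤ 2 * α := by nlinarith
    gcongr
  · refine tendsto_const_nhds.congr' ?_
    filter_upwards [self_mem_nhdsWithin] with α hα
    exact (setIntegral_one_sub_sq_rpow_kernel hα).symm
  · refine Eventually.of_forall fun α => Measurable.aestronglyMeasurable ?_
    fun_prop
  · exact (hg.integrableOn_Icc).mono_set Set.Ioo_subset_Icc_self
  · exact (hg.tendsto 1).mono_left nhdsWithin_le_nhds

theorem integrableOn_ball_one_sub_norm_sq_rpow {E : Type*} [NormedAddCommGroup E]
    [NormedSpace ℝ E] [FiniteDimensional ℝ E] [MeasurableSpace E] [BorelSpace E]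
    (μ : Measure E) [μ.IsAddHaarMeasure] (hE : 2 ≤ Module.finrank ℝ E) {α : ℝ} (hα : 0 < α) :
    IntegrableOn (fun y : E => (1 - ‖y‖ ^ 2) ^ (α - 1)) (ball 0 1) μ := by
  have : Nontrivial E := Module.nontrivial_of_finrank_pos (R := ℝ) (by omega)
  rw [integrableOn_fun_norm_addHaar μ (f := fun r : ℝ => (1 - r ^ 2) ^ (α - 1))]
  have hker : IntegrableOn (fun r : ℝ => 2 * α * r * (1 - r ^ 2) ^ (α - 1)) (Set.Ioo 0 1) :=
    (intervalIntegrable_iff_integrableOn_Ioo_of_le zero_le_one).1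
      (intervalIntegrable_one_sub_sq_rpow_kernel hα)
  have hmul : IntegrableOn (fun r : ℝ => r ^ (Module.finrank ℝ E - 2) *
      (2 * α * r * (1 - r ^ 2) ^ (α - 1))) (Set.Ioo 0 1) := by
    refine Integrable.bdd_mul (c := 1) hker (by fun_prop) ?_
    filter_upwards [ae_restrict_mem measurableSet_Ioo] with r hr
    rw [Real.norm_of_nonneg (pow_nonneg hr.1.le _)]
    exact pow_le_one₀ hr.1.le hr.2.le
  refine (hmul.const_mul (2 * α)⁻¹).congr (Eventually.of_forall fun r => ?_)
  obtain ⟨k, hk⟩ := Nat.exists_eq_add_of_le hE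
  have h1 : Module.finrank ℝ E - 1 = k + 1 := by omega
  have h2 : Module.finrank ℝ E - 2 = k := by omega
  simp only [h1, h2, smul_eq_mul]
  field_simp
  ring

theorem tendsto_inv_Gamma_div_self :
    Tendsto (fun α : ℝ => (Real.Gamma α)⁻¹ / α) (𝓝[>] 0) (𝓝 1) := by
  have hcont : Tendsto (fun α : ℝ => (Real.Gamma (α + 1))⁻¹) (𝓝[>] 0) (𝓝 1) := by
    have hΓ : ContinuousAt Real.Gamma (0 + 1) :=
      (Real.differentiableAt_Gamma fun m => ne_of_gt (by rw [zero_add]; linarith [(m.cast_nonneg : (0 : ℝ) ≤ m)])).continuousAt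
    have h : ContinuousAt (fun α : ℝ => Real.Gamma (α + 1)) 0 :=
      ContinuousAt.comp (f := fun α : ℝ => α + 1) hΓ (by fun_prop)
    simpa using (h.tendsto.inv₀ (by simp)).mono_left nhdsWithin_le_nhds
  refine hcont.congr' ?_
  filter_upwards [self_mem_nhdsWithin] with α hα
  rw [Real.Gamma_add_one (ne_of_gt hα), mul_inv_rev, div_eq_mul_inv]

/-- Polar coordinates for the weighted ball average with weight `(1-|y|²)^(α-1)`. -/
theorem setIntegral_ball_one_sub_norm_sq_rpow_smul {E F : Type*} [NormedAddCommGroup E]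
    [NormedSpace ℝ E] [FiniteDimensional ℝ E] [MeasurableSpace E] [BorelSpace E]
    [NormedAddCommGroup F] [NormedSpace ℝ F]
    (μ : Measure E) [μ.IsAddHaarMeasure] (hE : 2 ≤ Module.finrank ℝ E) {α : ℝ} (hα : 0 < α)
    {h : E → F} (hh : Continuous h) :
    (2 * α) • ∫ y in ball (0 : E) 1, (1 - ‖y‖ ^ 2) ^ (α - 1) • h y ∂μ =
      ∫ r in Set.Ioo (0 : ℝ) 1, (2 * α * r * (1 - r ^ 2) ^ (α - 1)) •
        r ^ (Module.finrank ℝ E - 2) • ∫ ω, h (r • (ω : E)) ∂μ.toSphere := by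
  have : Nontrivial E := Module.nontrivial_of_finrank_pos (R := ℝ) (by omega)
  have hint : IntegrableOn (fun y : E => (1 - ‖y‖ ^ 2) ^ (α - 1) • h y) (ball 0 1) μ := by
    obtain ⟨C, hC⟩ := (isCompact_closedBall (0 : E) 1).exists_bound_of_continuousOn hh.continuousOn
    refine Integrable.smul_bdd (integrableOn_ball_one_sub_norm_sq_rpow μ hE hα) C
      hh.aestronglyMeasurable ?_
    filter_upwards [ae_restrict_mem measurableSet_ball] with y hy
    exact hC y (ball_subset_closedBall hy)
  rw [← integral_indicator measurableSet_ball,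
    integral_eq_integral_Ioi_toSphere μ (hint.integrable_indicator measurableSet_ball),
    ← integral_smul, ← Set.Ioi_inter_Iio, ← setIntegral_indicator measurableSet_Iio]
  refine setIntegral_congr_fun measurableSet_Ioi fun r hr => ?_
  have hr0 : 0 < r := hr
  have hnorm : ∀ ω : sphere (0 : E) 1, ‖r • (ω : E)‖ = r := fun ω => by
    simp [norm_smul, abs_of_pos hr0]
  by_cases hr1 : r < 1
  · have hmem : ∀ ω : sphere (0 : E) 1, r • (ω : E) ∈ ball (0 : E) 1 := fun ω => by
      simpa [hnorm] using hr1
    obtain ⟨k, hk⟩ := Nat.exists_eq_add_of_le hE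
    have h1 : Module.finrank ℝ E - 1 = k + 1 := by omega
    have h2 : Module.finrank ℝ E - 2 = k := by omega
    simp only [Set.indicator_of_mem (hmem _), Set.indicator_of_mem (Set.mem_Iio.2 hr1), hnorm,
      integral_smul, smul_smul, h1, h2]
    ring_nf
  · have hmem : ∀ ω : sphere (0 : E) 1, r • (ω : E) ∉ ball (0 : E) 1 := fun ω => by
      simpa [hnorm] using hr1
    simp [Set.indicator_of_notMem (hmem _), hr1]

/-- As `α → 0⁺` (over real `α`), the analytic family of spherical means degenerates to the
spherical mean: `Γ(α)⁻¹ ∫_{|y|<1} (1-|y|²)^{α-1} f(x+ty) dy → (1/2) ∫_{S^{n-1}} f(x+tω) dS(ω)`. -/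
theorem spherical_means_limit_alpha_zero (n : ℕ) (hn : 2 ≤ n)
    (f : EuclideanSpace ℝ (Fin n) → ℂ) (hf : Continuous f) (hsupp : HasCompactSupport f)
    (x : EuclideanSpace ℝ (Fin n)) (t : ℝ) (ht : 0 < t) :
    Filter.Tendsto (fun α : ℝ =>
        (((Real.Gamma α)⁻¹ : ℝ) : ℂ) * ∫ y in {y : EuclideanSpace ℝ (Fin n) | ‖y‖ < 1},
          (((1 - ‖y‖ ^ 2 : ℝ) ^ (α - 1) : ℝ) : ℂ) * f (x + t • y))
      (nhdsWithin 0 (Set.Ioi 0))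
      (nhds ((1 / 2 : ℂ) *
        ∫ ω, f (x + t • (ω : EuclideanSpace ℝ (Fin n))) ∂(surfMeasure n))) := by
  let h : EuclideanSpace ℝ (Fin n) → ℂ := fun y => f (x + t • y)
  have hh : Continuous h := by fun_prop
  have hdim : Module.finrank ℝ (EuclideanSpace ℝ (Fin n)) = n := finrank_euclideanSpace_fin
  have hsphere : Continuous fun r : ℝ => r ^ (n - 2) •
      ∫ ω, h (r • (ω : EuclideanSpace ℝ (Fin n))) ∂(surfMeasure n) := by
    obtain ⟨C, hC⟩ := hsupp.exists_bound_of_continuous hf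
    have : IsFiniteMeasure (surfMeasure n) := by unfold surfMeasure; infer_instance
    refine (continuous_pow _).smul (continuous_of_dominated (bound := fun _ => C)
      (fun r => Continuous.aestronglyMeasurable (by fun_prop))
      (fun r => Eventually.of_forall fun ω => hC _) (integrable_const C)
      (Eventually.of_forall fun ω => by fun_prop))
  have hlim := (tendsto_inv_Gamma_div_self.smul
    (tendsto_setIntegral_one_sub_sq_rpow_kernel_smul hsphere)).const_smul (1 / 2 : ℝ)
  have hval : (1 / 2 : ℝ) • (1 : ℝ) • ((1 : ℝ) ^ (n - 2) •
      ∫ ω, h ((1 : ℝ) • (ω : EuclideanSpace ℝ (Fin n))) ∂(surfMeasure n)) =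
      (1 / 2 : ℂ) * ∫ ω, f (x + t • (ω : EuclideanSpace ℝ (Fin n))) ∂(surfMeasure n) := by
    simp [h]
  rw [hval] at hlim
  refine hlim.congr' ?_
  filter_upwards [self_mem_nhdsWithin] with α hα
  have hα0 : α ≠ 0 := ne_of_gt hα
  have hpolar := setIntegral_ball_one_sub_norm_sq_rpow_smul
    (volume : Measure (EuclideanSpace ℝ (Fin n))) (hdim.symm ▸ hn) hα hh
  rw [hdim] at hpolar
  have hball : {y : EuclideanSpace ℝ (Fin n) | ‖y‖ < 1} = ball 0 1 := by ext; simp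
  simp only [surfMeasure, hball, ← Complex.real_smul]
  rw [← hpolar, smul_smul, smul_smul]
  congr 1
  field_simp
end
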